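/- Let Γ be a finite simplicial connected graph with at least 3 vertices, with no cut-vertices, and with no induced cycles of length greater than or equal to 4. Then every edge of Γ is contained in a triangle; that is, for every edge (u,v) of Γ there is a vertex w adjacent to both u and v. -/

import Mathlib

/-- A simple graph has no induced cycles of length `≥ 4` if there is no embedding of
the cycle graph on `n ≥ 4` vertices onto an induced subgraph (i.e. no family of `n`
distinct vertices whose only adjacencies are the consecutive ones along the cycle). -/
def NoLongInducedCycles {V : Type*} (G : SimpleGraph V) : Prop :=
  ¬ ∃ (n : ℕ) (_ : 4 ≤ n) (f : Fin n ↪ V),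
      ∀ i j : Fin n, G.Adj (f i) (f j) ↔ (SimpleGraph.cycleGraph n).Adj i j

/-- A finite connected simple graph on at least `3` vertices, with no cut-vertices
(removing any single vertex leaves the graph connected) and no induced cycles of
length `≥ 4`, has every edge contained in a triangle. -/
theorem every_edge_in_triangle {V : Type*} [Fintype V] (G : SimpleGraph V)
    (hconn : G.Connected) (hcard : 3 ≤ Fintype.card V)
    (hnocut : ∀ v : V, (G.induce ({v}ᶜ : Set V)).Connected)
    (hG : NoLongInducedCycles G) :
    ∀ u v : V, G.Adj u v → ∃ w : V, G.Adj u w ∧ G.Adj v w := by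
  classical
  intro u v huv
  have hne : u ≠ v := huv.ne
  obtain ⟨w, hw⟩ : ∃ w, w ∉ ({u, v} : Finset V) := by
    by_contra! h
    have h1 : (Finset.univ : Finset V) ⊆ {u, v} := fun x _ => h x
    have h2 := Finset.card_le_card h1
    have h3 := Finset.card_le_two (a := u) (b := v)
    rw [Finset.card_univ] at h2
    omega
  simp only [Finset.mem_insert, Finset.mem_singleton, not_or] at hw
  obtain ⟨hwu, hwv⟩ := hw
  let H : SimpleGraph V := G.deleteEdges {s(u, v)}
  have hH : ∀ a b, H.Adj a b ↔ G.Adj a b ∧ ¬ (a = u ∧ b = v ∨ a = v ∧ b = u) := by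
    intro a b
    simp [H]
  have key : ∀ z a b : V, (z = u ∨ z = v) → a ≠ z → b ≠ z → H.Reachable a b := by
    intro z a b hz ha hb
    let f : (G.induce ({z}ᶜ : Set V)) →g H :=
      { toFun := Subtype.val
        map_rel' := by
          rintro ⟨x, hx⟩ ⟨y, hy⟩ hxy
          simp only [SimpleGraph.comap_adj, Function.Embedding.subtype_apply] at hxy
          simp only [Set.mem_compl_iff, Set.mem_singleton_iff] at hx hy
          rw [hH]
          refine ⟨hxy, ?_⟩
          grind }
    exact ((hnocut z).preconnected ⟨a, ha⟩ ⟨b, hb⟩).map f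
  have hr : H.Reachable u v :=
    (key v u w (Or.inr rfl) hne hwv).trans (key u w v (Or.inl rfl) hwu hne.symm)
  obtain ⟨p, hp⟩ := hr.exists_walk_length_eq_dist
  have hd : ∀ i, i ≤ p.length → H.dist u (p.getVert i) = i := by
    intro i hi
    have h1 := SimpleGraph.dist_le (p.take i)
    have h2 := SimpleGraph.dist_le (p.drop i)
    have h3 := (p.take i).reachable.dist_triangle_left v
    rw [SimpleGraph.Walk.take_length] at h1
    rw [SimpleGraph.Walk.drop_length] at h2
    omega
  have hinj : ∀ i j, i ≤ p.length → j ≤ p.length → p.getVert i = p.getVert j → i = j := by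
    intro i j hi hj h
    rw [← hd i hi, ← hd j hj, h]
  have hadj : ∀ i j, i ≤ p.length → j ≤ p.length →
      (H.Adj (p.getVert i) (p.getVert j) ↔ i = j + 1 ∨ j = i + 1) := by
    intro i j hi hj
    constructor
    · intro h
      have h1 := h.diff_dist_adj (u := u)
      rw [hd i hi, hd j hj] at h1
      have h2 : i ≠ j := by
        rintro rfl
        exact h.ne rfl
      omega
    · rintro (rfl | rfl)
      · exact (p.adj_getVert_succ (by omega)).symm
      · exact p.adj_getVert_succ (by omega)
  have h0 := p.getVert_zero
  have hL := p.getVert_length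
  have hlen : 2 ≤ p.length := by
    by_contra! hlt
    have h1 : p.length ≠ 0 := by
      intro h
      rw [h, h0] at hL
      exact hne hL
    have h2 := (hadj 0 p.length (by omega) le_rfl).2 (by omega)
    rw [h0, hL, hH] at h2
    exact h2.2 (Or.inl ⟨rfl, rfl⟩)
  by_cases h2 : p.length = 2
  · refine ⟨p.getVert 1, ?_, ?_⟩
    · have := (hadj 0 1 (by omega) (by omega)).2 (by omega)
      rw [h0, hH] at this
      exact this.1
    · have := (hadj p.length 1 (by omega) (by omega)).2 (by omega)
      rw [hL, hH] at this
      exact this.1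
  · exfalso
    apply hG
    refine ⟨p.length + 1, by omega, ⟨fun i => p.getVert i, ?_⟩, ?_⟩
    · intro i j h
      exact Fin.ext (hinj i j (by omega) (by omega) h)
    · intro i j
      have hi : i.val ≤ p.length := by omega
      have hj : j.val ≤ p.length := by omega
      have hGa : G.Adj (p.getVert i) (p.getVert j) ↔
          (i.val = j + 1 ∨ j.val = i + 1) ∨
            (i.val = 0 ∧ j.val = p.length ∨ i.val = p.length ∧ j.val = 0) := by
        rw [← hadj i j hi hj, hH]
        have eu : ∀ k, k ≤ p.length → (p.getVert k = u ↔ k = 0) := fun k hk =>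
          ⟨fun h => hinj k 0 hk (by omega) (h.trans h0.symm), fun h => by rw [h, h0]⟩
        have ev : ∀ k, k ≤ p.length → (p.getVert k = v ↔ k = p.length) := fun k hk =>
          ⟨fun h => hinj k _ hk le_rfl (h.trans hL.symm), fun h => by rw [h, hL]⟩
        rw [eu i hi, eu j hj, ev i hi, ev j hj]
        constructor
        · tauto
        · rintro (h | ⟨h, h'⟩ | ⟨h, h'⟩)
          · exact h.1
          · rw [h, h', h0, hL]; exact huv
          · rw [h, h', h0, hL]; exact huv.symm
      refine hGa.trans ?_
      rw [SimpleGraph.cycleGraph_adj']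
      rcases lt_trichotomy i j with h | h | h
      · rw [Fin.sub_val_of_le h.le, Fin.coe_sub_iff_lt.2 h]
        have := Fin.lt_def.1 h
        omega
      · subst h
        rw [Fin.sub_val_of_le le_rfl]
        omega
      · rw [Fin.sub_val_of_le h.le, Fin.coe_sub_iff_lt.2 h]
        have := Fin.lt_def.1 h
        omega
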